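/- Let Δ : M₂(ℂ) → M₂(ℂ)⊗M₂(ℂ) be a linear map of the form Δ(w₀·1 + w·σ) = w₀·(1⊗1) + Σ_{m,l} (Σ_k b_{ml,k} w_k) σ_m⊗σ_l with real coefficients b_{ml,k}. Then the functional x ↦ (φ⊗ψ)(Δx) is a state on M₂(ℂ) for every pair of states φ, ψ on M₂(ℂ) if and only if Σ_{k=1}^{3} |Σ_{i,j=1}^{3} b_{ij,k} f_i p_j|² ≤ 1 for all f, p in the closed unit ball S = {f ∈ ℝ³ : ‖f‖ ≤ 1}. -/

import Mathlib

open Matrix Complex Kronecker ComplexOrder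

/-- `M₂(ℂ)`. -/
abbrev M2 : Type := Matrix (Fin 2) (Fin 2) ℂ

/-- `M₂(ℂ) ⊗ M₂(ℂ)` identified with `M₄(ℂ)` via the Kronecker product. -/
abbrev M4 : Type := Matrix (Fin 2 × Fin 2) (Fin 2 × Fin 2) ℂ

/-- The Pauli matrices `σ₁, σ₂, σ₃`. -/
noncomputable def Pauli : Fin 3 → M2 :=
  ![!![0, 1; 1, 0], !![0, -Complex.I; Complex.I, 0], !![1, 0; 0, -1]]

/-- A state on `M₂(ℂ)`: a unital linear functional that is nonnegative on
positive semidefinite matrices. -/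
def IsState (φ : M2 →ₗ[ℂ] ℂ) : Prop :=
  φ 1 = 1 ∧ ∀ x : M2, x.PosSemidef → 0 ≤ φ x

/-- The tensor product `φ ⊗ ψ` of two linear functionals on `M₂(ℂ)`, viewed as a
linear functional on `M₄(ℂ) = M₂(ℂ) ⊗ M₂(ℂ)`; it is the unique linear functional
with `(φ⊗ψ)(a ⊗ b) = φ(a)ψ(b)`. -/
noncomputable def tensorFunc (φ ψ : M2 →ₗ[ℂ] ℂ) : M4 →ₗ[ℂ] ℂ where
  toFun y := ∑ i : Fin 2, ∑ j : Fin 2, ∑ k : Fin 2, ∑ l : Fin 2,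
    y (i, k) (j, l) * (φ (Matrix.single i j 1) * ψ (Matrix.single k l 1))
  map_add' y z := by
    simp [Matrix.add_apply, add_mul, Finset.sum_add_distrib]
  map_smul' c y := by
    simp [Matrix.smul_apply, smul_eq_mul, Finset.mul_sum]
    ring

/-- The functional `w₀ • 1 + ∑ k, w k • Pauli k ↦ w₀ + ∑ k, w k * f k`. -/
noncomputable def blochFunctional (f : Fin 3 → ℝ) : M2 →ₗ[ℂ] ℂ where
  toFun x := (x 0 0 + x 1 1) / 2 + f 0 * ((x 0 1 + x 1 0) / 2)
    + f 1 * (Complex.I * (x 0 1 - x 1 0) / 2) + f 2 * ((x 0 0 - x 1 1) / 2)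
  map_add' x y := by simp only [Matrix.add_apply]; ring
  map_smul' c x := by simp only [Matrix.smul_apply, smul_eq_mul, RingHom.id_apply]; ring

theorem blochFunctional_one (f : Fin 3 → ℝ) : blochFunctional f 1 = 1 := by
  simp [blochFunctional]

theorem blochFunctional_pauli (f : Fin 3 → ℝ) (k : Fin 3) :
    blochFunctional f (Pauli k) = f k := by
  fin_cases k
  · simp [blochFunctional, Pauli]
  · have h : Complex.I * (-Complex.I - Complex.I) / 2 = 1 := by
      linear_combination -Complex.I_mul_I
    simp [blochFunctional, Pauli, h]
  · simp [blochFunctional, Pauli]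

theorem eq_pauli_expansion (x : M2) :
    x = ((x 0 0 + x 1 1) / 2) • (1 : M2)
      + ∑ k, ![(x 0 1 + x 1 0) / 2, Complex.I * (x 0 1 - x 1 0) / 2,
        (x 0 0 - x 1 1) / 2] k • Pauli k := by
  ext i j
  fin_cases i <;> fin_cases j <;> simp [Fin.sum_univ_three, Pauli]
  · ring
  · linear_combination (x 0 1 - x 1 0) / 2 * Complex.I_mul_I
  · linear_combination -(x 0 1 - x 1 0) / 2 * Complex.I_mul_I
  · ring

theorem eq_blochFunctional {φ : M2 →ₗ[ℂ] ℂ} {f : Fin 3 → ℝ} (h1 : φ 1 = 1)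
    (hf : ∀ k, φ (Pauli k) = f k) : φ = blochFunctional f := by
  ext1 x
  rw [eq_pauli_expansion x]
  simp only [map_add, map_sum, map_smul, h1, hf, blochFunctional_one, blochFunctional_pauli]

/-- The matrix is half the square of the Hermitian matrix `1 + ∑ k, f k • Pauli k`. -/
theorem posSemidef_half_pauli_square (f : Fin 3 → ℝ) :
    ((((1 + ∑ k, f k ^ 2) / 2 : ℝ) : ℂ) • (1 : M2)
      + ∑ k, (f k : ℂ) • Pauli k).PosSemidef := by
  have key : (((1 + ∑ k, f k ^ 2) / 2 : ℝ) : ℂ) • (1 : M2) + ∑ k, (f k : ℂ) • Pauli k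
      = (1 / 2 : ℂ) • ((1 + ∑ k, (f k : ℂ) • Pauli k)ᴴ * (1 + ∑ k, (f k : ℂ) • Pauli k)) := by
    ext i j
    fin_cases i <;> fin_cases j <;>
      simp [Fin.sum_univ_three, Pauli, Matrix.mul_apply, Fin.sum_univ_two] <;>
      ring_nf <;> simp only [Complex.I_sq] <;> ring
  rw [key]
  exact (Matrix.posSemidef_conjTranspose_mul_self _).smul (by positivity)

theorem isState_blochFunctional {f : Fin 3 → ℝ} (hf : f 0 ^ 2 + f 1 ^ 2 + f 2 ^ 2 ≤ 1) :
    IsState (blochFunctional f) := by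
  refine ⟨blochFunctional_one f, fun x hx => ?_⟩
  have h10 : x 1 0 = star (x 0 1) := (hx.isHermitian.apply 1 0).symm
  have h00 := Complex.nonneg_iff.1 (hx.diag_nonneg (i := 0))
  have h11 := Complex.nonneg_iff.1 (hx.diag_nonneg (i := 1))
  have hdet := (Complex.nonneg_iff.1 hx.det_nonneg).1
  rw [Matrix.det_fin_two, h10] at hdet
  rw [Complex.nonneg_iff]
  simp only [blochFunctional, LinearMap.coe_mk, AddHom.coe_mk, h10]
  obtain ⟨a, ha⟩ : ∃ a : ℝ, x 0 0 = a := ⟨_, Complex.ext rfl (by simp [← h00.2])⟩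
  obtain ⟨d, hd⟩ : ∃ d : ℝ, x 1 1 = d := ⟨_, Complex.ext rfl (by simp [← h11.2])⟩
  rw [ha] at h00 hdet
  rw [hd] at h11 hdet
  rw [ha, hd]
  simp at h00 h11 hdet ⊢
  set u := (x 0 1).re
  set v := (x 0 1).im
  have hw : u ^ 2 + v ^ 2 + ((a - d) / 2) ^ 2 ≤ ((a + d) / 2) ^ 2 := by linarith
  have hcs : (f 0 * u - f 1 * v + f 2 * ((a - d) / 2)) ^ 2
      ≤ (f 0 ^ 2 + f 1 ^ 2 + f 2 ^ 2) * (u ^ 2 + v ^ 2 + ((a - d) / 2) ^ 2) := by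
    linarith [sq_nonneg (f 0 * v + f 1 * u), sq_nonneg (f 0 * ((a - d) / 2) - f 2 * u),
      sq_nonneg (f 1 * ((a - d) / 2) + f 2 * v)]
  have hle : (f 0 * u - f 1 * v + f 2 * ((a - d) / 2)) ^ 2 ≤ ((a + d) / 2) ^ 2 :=
    hcs.trans ((mul_le_of_le_one_left (by positivity) hf).trans hw)
  have := (abs_le.1 (abs_le_of_sq_le_sq hle (by linarith))).1
  linarith

theorem IsState.exists_bloch {φ : M2 →ₗ[ℂ] ℂ} (hφ : IsState φ) :
    ∃ f : Fin 3 → ℝ, f 0 ^ 2 + f 1 ^ 2 + f 2 ^ 2 ≤ 1 ∧ ∀ k, φ (Pauli k) = f k := by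
  have hreal : ∀ k, φ (Pauli k) = ((φ (Pauli k)).re : ℂ) := fun k => by
    have h := hφ.2 _ (posSemidef_half_pauli_square (Pi.single k 1))
    have h' := (Complex.nonneg_iff.1 h).2
    refine Complex.ext rfl ?_
    simpa [map_sum, hφ.1, Pi.single_apply, -Complex.ofReal_add] using h'.symm
  refine ⟨fun k => (φ (Pauli k)).re, ?_, hreal⟩
  have h := (Complex.nonneg_iff.1
    (hφ.2 _ (posSemidef_half_pauli_square fun k => -(φ (Pauli k)).re))).1
  simp only [map_add, map_smul, hφ.1, smul_eq_mul, mul_one, Fin.sum_univ_three,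
    Complex.add_re, Complex.re_ofReal_mul, Complex.ofReal_re] at h
  linarith

theorem IsState.sum_sq_le_one {φ : M2 →ₗ[ℂ] ℂ} (hφ : IsState φ) {f : Fin 3 → ℝ}
    (hf : ∀ k, φ (Pauli k) = f k) : f 0 ^ 2 + f 1 ^ 2 + f 2 ^ 2 ≤ 1 := by
  obtain ⟨g, hg, hgf⟩ := hφ.exists_bloch
  have : f = g := funext fun k => Complex.ofReal_injective ((hf k).symm.trans (hgf k))
  rwa [this]

theorem tensorFunc_kronecker (φ ψ : M2 →ₗ[ℂ] ℂ) (x y : M2) :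
    tensorFunc φ ψ (x ⊗ₖ y) = φ x * ψ y := by
  have expand : ∀ (χ : M2 →ₗ[ℂ] ℂ) (z : M2),
      χ z = ∑ i, ∑ j, z i j * χ (Matrix.single i j 1) := fun χ z => by
    conv_lhs => rw [Matrix.matrix_eq_sum_single z]
    simp only [map_sum]
    refine Finset.sum_congr rfl fun i _ => Finset.sum_congr rfl fun j _ => ?_
    rw [← smul_eq_mul, ← map_smul, Matrix.smul_single, smul_eq_mul, mul_one]
  rw [expand φ x, expand ψ y]
  simp only [tensorFunc, LinearMap.coe_mk, AddHom.coe_mk, Matrix.kroneckerMap_apply,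
    Fin.sum_univ_two]
  ring

theorem tensorFunc_one (φ ψ : M2 →ₗ[ℂ] ℂ) : tensorFunc φ ψ 1 = φ 1 * ψ 1 := by
  rw [← tensorFunc_kronecker, Matrix.one_kronecker_one]

theorem tensorFunc_comp_eq {Δ : M2 →ₗ[ℂ] M4} {b : Fin 3 → Fin 3 → Fin 3 → ℝ}
    (hb : ∀ (w₀ : ℂ) (w : Fin 3 → ℂ),
        Δ (w₀ • (1 : M2) + ∑ k, w k • Pauli k)
          = w₀ • (1 : M4)
            + ∑ m, ∑ l, (∑ k, (b m l k : ℂ) * w k) • (Pauli m ⊗ₖ Pauli l))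
    (f p : Fin 3 → ℝ) :
    (tensorFunc (blochFunctional f) (blochFunctional p)).comp Δ
      = blochFunctional fun k => ∑ i, ∑ j, b i j k * f i * p j := by
  refine eq_blochFunctional ?_ fun k => ?_
  · have h := hb 1 0
    simp at h
    simp [h, tensorFunc_one, blochFunctional_one]
  · have h := hb 0 (Pi.single k 1)
    simp [Pi.single_apply] at h
    simp [h, tensorFunc_kronecker, blochFunctional_pauli, mul_assoc]

/-- For a linear map `Δ` of the canonical form with real coefficients `b`, the
functional `x ↦ (φ⊗ψ)(Δ x)` is a state for all states `φ, ψ` iff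
`∑_k |∑_{i,j} b_{ij,k} f_i p_j|² ≤ 1` for all `f, p` in the closed unit ball. -/
theorem state_iff_coeff_bound (Δ : M2 →ₗ[ℂ] M4)
    (b : Fin 3 → Fin 3 → Fin 3 → ℝ)
    (hb : ∀ (w₀ : ℂ) (w : Fin 3 → ℂ),
        Δ (w₀ • (1 : M2) + ∑ k, w k • Pauli k)
          = w₀ • (1 : M4)
            + ∑ m, ∑ l, (∑ k, (b m l k : ℂ) * w k) • (Pauli m ⊗ₖ Pauli l)) :
    (∀ φ ψ : M2 →ₗ[ℂ] ℂ, IsState φ → IsState ψ → IsState ((tensorFunc φ ψ).comp Δ))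
      ↔ ∀ f p : Fin 3 → ℝ, f 0 ^ 2 + f 1 ^ 2 + f 2 ^ 2 ≤ 1 →
          p 0 ^ 2 + p 1 ^ 2 + p 2 ^ 2 ≤ 1 →
          ∑ k, (∑ i, ∑ j, b i j k * f i * p j) ^ 2 ≤ 1 := by
  constructor
  · intro h f p hf hp
    have hs := h _ _ (isState_blochFunctional hf) (isState_blochFunctional hp)
    rw [tensorFunc_comp_eq hb] at hs
    rw [Fin.sum_univ_three]
    exact hs.sum_sq_le_one (blochFunctional_pauli _)
  · intro h φ ψ hφ hψ
    obtain ⟨f, hf, hφf⟩ := hφ.exists_bloch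
    obtain ⟨p, hp, hψp⟩ := hψ.exists_bloch
    have hfp := h f p hf hp
    rw [Fin.sum_univ_three] at hfp
    rw [eq_blochFunctional hφ.1 hφf, eq_blochFunctional hψ.1 hψp, tensorFunc_comp_eq hb]
    exact isState_blochFunctional hfp
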